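/- Let n ≥ 1 and let L : ℝⁿ → ℝ be three times continuously differentiable with globally bounded third derivative. Fix w ∈ ℝⁿ. For ρ > 0, let μ_ρ be the law of a random vector γ ∈ ℝⁿ with independent coordinates γᵢ ~ N(0, ρ²). Then lim_{ρ → 0⁺} (2/ρ²) · ( ∫ L(w + γ ⊙ |w|) dμ_ρ(γ) − L(w) ) = Σᵢ (∂²L/∂wᵢ²)(w) · wᵢ², which equals the trace of the Hadamard product ∇²L(w) ⊙ (|w||w|ᵀ). -/

import Mathlib

open MeasureTheory ProbabilityTheory Filter

set_option maxSynthPendingDepth 3 in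
lemma aux_taylor {E : Type*} [NormedAddCommGroup E] [NormedSpace ℝ E] (L : E → ℝ)
    (hL : ContDiff ℝ 3 L) (C : ℝ) (hC : ∀ x, ‖iteratedFDeriv ℝ 3 L x‖ ≤ C) (w v : E) :
    |L (w + v) - L w - fderiv ℝ L w v - 1 / 2 * fderiv ℝ (fderiv ℝ L) w v v| ≤ C * ‖v‖ ^ 3 := by
  have hC0 : 0 ≤ C := (norm_nonneg _).trans (hC w)
  have hD1 : ContDiff ℝ 2 (fderiv ℝ L) := hL.fderiv_right (by norm_num)
  have hD2 : ContDiff ℝ 1 (fderiv ℝ (fderiv ℝ L)) := hD1.fderiv_right (by norm_num)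
  have dL : Differentiable ℝ L := hL.differentiable (by norm_num)
  have dD1 : Differentiable ℝ (fderiv ℝ L) := hD1.differentiable (by norm_num)
  have dD2 : Differentiable ℝ (fderiv ℝ (fderiv ℝ L)) := hD2.differentiable (by norm_num)
  have h3 : ∀ x, ‖fderiv ℝ (fderiv ℝ (fderiv ℝ L)) x‖ ≤ C := by
    intro x
    rw [← norm_iteratedFDeriv_one, norm_iteratedFDeriv_fderiv, norm_iteratedFDeriv_fderiv]
    exact hC x
  have lip : ∀ x, ‖fderiv ℝ (fderiv ℝ L) x - fderiv ℝ (fderiv ℝ L) w‖ ≤ C * ‖x - w‖ := fun x =>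
    Convex.norm_image_sub_le_of_norm_fderiv_le (s := Set.univ) (fun y _ => dD2 y)
      (fun y _ => h3 y) convex_univ (Set.mem_univ _) (Set.mem_univ _)
  set r := ‖v‖ with hr
  have h1 : ∀ x ∈ Metric.closedBall w r,
      ‖fderiv ℝ L x - fderiv ℝ L w - fderiv ℝ (fderiv ℝ L) w (x - w)‖ ≤ C * r * r := by
    intro x hx
    have hd : ∀ y ∈ Metric.closedBall w r, HasFDerivWithinAt
        (fun y => fderiv ℝ L y - fderiv ℝ (fderiv ℝ L) w y)
        (fderiv ℝ (fderiv ℝ L) y - fderiv ℝ (fderiv ℝ L) w) (Metric.closedBall w r) y :=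
      fun y _ => ((dD1 y).hasFDerivAt.sub
        (fderiv ℝ (fderiv ℝ L) w).hasFDerivAt).hasFDerivWithinAt
    have := Convex.norm_image_sub_le_of_norm_hasFDerivWithin_le (C := C * r) hd
      (fun y hy => (lip y).trans (by
        gcongr; simpa [dist_eq_norm] using hy)) (convex_closedBall w r)
        (Metric.mem_closedBall_self (norm_nonneg v)) hx
    have hxr : ‖x - w‖ ≤ r := by simpa [dist_eq_norm] using hx
    calc _ = _ := by congr 1; rw [map_sub]; abel
      _ ≤ _ := this
      _ ≤ _ := by gcongr
  -- one dimensional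
  have hd : ∀ t ∈ Set.Icc (0:ℝ) 1, HasDerivWithinAt
      (fun t : ℝ => L (w + t • v) - t * fderiv ℝ L w v
        - t ^ 2 / 2 * fderiv ℝ (fderiv ℝ L) w v v)
      (fderiv ℝ L (w + t • v) v - fderiv ℝ L w v - t * fderiv ℝ (fderiv ℝ L) w v v)
      (Set.Icc (0:ℝ) 1) t := by
    intro t _
    apply HasDerivAt.hasDerivWithinAt
    have e1 : HasDerivAt (fun t : ℝ => w + t • v) v t := by
      simpa using ((hasDerivAt_id t).smul_const v).const_add w
    have e2 := (dL (w + t • v)).hasFDerivAt.comp_hasDerivAt t e1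
    have e3 := (hasDerivAt_id t).mul_const (fderiv ℝ L w v)
    have e4 := (((hasDerivAt_id t).pow 2).div_const 2).mul_const
      (fderiv ℝ (fderiv ℝ L) w v v)
    convert (e2.sub e3).sub e4 using 1
    · rfl
    · simp
  have := Convex.norm_image_sub_le_of_norm_hasDerivWithin_le (C := C * r ^ 3) hd
    (fun t ht => by
      have hx : w + t • v ∈ Metric.closedBall w r := by
        simp only [Metric.mem_closedBall, dist_eq_norm, add_sub_cancel_left, norm_smul,
          Real.norm_eq_abs, abs_of_nonneg ht.1]
        exact mul_le_of_le_one_left (norm_nonneg _) ht.2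
      have h := h1 _ hx
      calc _ = ‖(fderiv ℝ L (w + t • v) - fderiv ℝ L w
                - fderiv ℝ (fderiv ℝ L) w (w + t • v - w)) v‖ := by simp
        _ ≤ _ := ContinuousLinearMap.le_opNorm _ _
        _ ≤ (C * r * r) * r := by gcongr
        _ = _ := by ring)
    (convex_Icc 0 1) (Set.left_mem_Icc.2 zero_le_one) (Set.right_mem_Icc.2 zero_le_one)
  rw [Real.norm_eq_abs] at this
  simp only [one_smul, zero_smul] at this
  norm_num at this
  convert this using 2
  ring

lemma aux_sq : ∫ x, x * x ∂(gaussianReal 0 1) = 1 := by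
  have h := variance_id_gaussianReal (μ := 0) (v := 1)
  rw [variance_of_integral_eq_zero (by fun_prop) (by simp)] at h
  simpa [pow_two] using h

lemma aux_cross (n : ℕ) (i j : Fin n) :
    Integrable (fun γ : Fin n → ℝ => γ i * γ j) (Measure.pi fun _ : Fin n => gaussianReal 0 1) ∧
    ∫ γ : Fin n → ℝ, γ i * γ j ∂(Measure.pi fun _ : Fin n => gaussianReal 0 1)
      = if i = j then 1 else 0 := by
  have hm : ∀ k : Fin n, MemLp (fun γ : Fin n → ℝ => γ k) 2
      (Measure.pi fun _ : Fin n => gaussianReal 0 1) := fun k =>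
    (memLp_id_gaussianReal' (μ := 0) (v := 1) 2 (by simp)).comp_measurePreserving
      (measurePreserving_eval (fun _ : Fin n => gaussianReal 0 1) k)
  refine ⟨(hm i).integrable_mul (hm j), ?_⟩
  split_ifs with h
  · subst h
    rw [integral_comp_eval (μ := fun _ : Fin n => gaussianReal 0 1) (i := i)
      (f := fun x : ℝ => x * x) (by fun_prop), aux_sq]
  · have hi := (iIndepFun_pi (μ := fun _ : Fin n => gaussianReal 0 1)
      (X := fun _ x => x) (fun _ => by fun_prop)).indepFun h
    rw [hi.integral_fun_mul_eq_mul_integral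
      (measurable_pi_apply i).aestronglyMeasurable (measurable_pi_apply j).aestronglyMeasurable,
      integral_comp_eval (μ := fun _ : Fin n => gaussianReal 0 1) (i := i)
      (f := fun x : ℝ => x) (by fun_prop)]
    simp

lemma aux_lin (n : ℕ) (i : Fin n) :
    Integrable (fun γ : Fin n → ℝ => γ i) (Measure.pi fun _ : Fin n => gaussianReal 0 1) ∧
    ∫ γ : Fin n → ℝ, γ i ∂(Measure.pi fun _ : Fin n => gaussianReal 0 1) = 0 := by
  constructor
  · exact memLp_one_iff_integrable.1
      ((memLp_id_gaussianReal' (μ := 0) (v := 1) 1 (by simp)).comp_measurePreserving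
      (measurePreserving_eval (fun _ : Fin n => gaussianReal 0 1) i))
  · rw [integral_comp_eval (μ := fun _ : Fin n => gaussianReal 0 1) (i := i)
      (f := fun x : ℝ => x) (by fun_prop)]
    simp

lemma aux_cube (n : ℕ) :
    Integrable (fun γ : Fin n → ℝ => ‖γ‖ ^ 3) (Measure.pi fun _ : Fin n => gaussianReal 0 1) := by
  have hi : ∀ i : Fin n, Integrable (fun γ : Fin n → ℝ => ‖γ i‖ ^ 3)
      (Measure.pi fun _ : Fin n => gaussianReal 0 1) := fun i =>
    ((memLp_id_gaussianReal' (μ := 0) (v := 1) 3 (by simp)).comp_measurePreserving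
      (measurePreserving_eval (fun _ : Fin n => gaussianReal 0 1) i)).integrable_norm_pow
        (by norm_num)
  refine (integrable_finsetSum Finset.univ fun i _ => hi i).mono' (by fun_prop) ?_
  refine Eventually.of_forall fun γ => ?_
  rw [Real.norm_eq_abs, abs_of_nonneg (by positivity)]
  rcases isEmpty_or_nonempty (Fin n) with h | h
  · simp [Subsingleton.elim γ 0]
  · obtain ⟨i, hi⟩ := Finite.exists_max (fun i => ‖γ i‖)
    have : ‖γ‖ ≤ ‖γ i‖ := (pi_norm_le_iff_of_nonneg (norm_nonneg _)).2 hi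
    calc ‖γ‖ ^ 3 ≤ ‖γ i‖ ^ 3 := by gcongr
      _ ≤ _ := Finset.single_le_sum (f := fun i => ‖γ i‖ ^ 3)
        (fun i _ => by positivity) (Finset.mem_univ i)

lemma aux_scale (n : ℕ) (ρ : ℝ) (f : (Fin n → ℝ) → ℝ) (hf : Continuous f) :
    ∫ γ : Fin n → ℝ, f γ ∂(Measure.pi fun _ : Fin n => gaussianReal 0 ((ρ ^ 2).toNNReal))
    = ∫ γ : Fin n → ℝ, f (ρ • γ) ∂(Measure.pi fun _ : Fin n => gaussianReal 0 1) := by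
  have h1 : gaussianReal 0 ((ρ ^ 2).toNNReal) = (gaussianReal 0 1).map (ρ * ·) := by
    rw [gaussianReal_map_const_mul]
    congr 1
    · simp
    · ext; simp [sq_nonneg]
  have h2 : (Measure.pi fun _ : Fin n => gaussianReal 0 ((ρ ^ 2).toNNReal))
      = (Measure.pi fun _ : Fin n => gaussianReal 0 1).map (fun γ => ρ • γ) := by
    simp_rw [h1]
    haveI : ∀ i : Fin n, SigmaFinite ((gaussianReal 0 1).map (ρ * ·)) := fun i => by
      rw [← h1]; infer_instance
    rw [← Measure.pi_map_pi (μ := fun _ : Fin n => gaussianReal 0 1)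
      (f := fun _ x => ρ * x) (fun _ => by fun_prop)]
    rfl
  rw [h2, integral_map (by fun_prop) hf.aestronglyMeasurable]

/-- Small-radius asymptotics of average-case elementwise adaptive sharpness:
`lim_{ρ→0⁺} (2/ρ²) (E[L(w + γ ⊙ |w|)] − L(w)) = ∑ᵢ ∂²L/∂wᵢ²(w) wᵢ²`,
which equals the trace of the Hadamard product `∇²L(w) ⊙ |w||w|ᵀ`. -/
theorem avg_case_adaptive_sharpness_small_rho
    (n : ℕ) (hn : 1 ≤ n) (L : (Fin n → ℝ) → ℝ)
    (hL : ContDiff ℝ 3 L) (hbdd : ∃ C : ℝ, ∀ x, ‖iteratedFDeriv ℝ 3 L x‖ ≤ C)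
    (w : Fin n → ℝ) :
    Tendsto (fun ρ : ℝ => (2 / ρ ^ 2) *
        ((∫ γ : Fin n → ℝ, L (w + fun i => γ i * |w i|)
            ∂(Measure.pi fun _ : Fin n => gaussianReal 0 ((ρ ^ 2).toNNReal))) - L w))
      (nhdsWithin 0 (Set.Ioi 0))
      (nhds (∑ i, fderiv ℝ (fun x => fderiv ℝ L x (Pi.single i 1)) w (Pi.single i 1)
        * w i ^ 2)) ∧
    (∑ i, fderiv ℝ (fun x => fderiv ℝ L x (Pi.single i 1)) w (Pi.single i 1) * w i ^ 2)
      = Matrix.trace (Matrix.of fun i j : Fin n =>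
          fderiv ℝ (fun x => fderiv ℝ L x (Pi.single j 1)) w (Pi.single i 1)
            * (|w i| * |w j|)) := by
  refine ⟨?_, by simp [Matrix.trace, pow_two]⟩
  obtain ⟨C, hC⟩ := hbdd
  have hC0 : 0 ≤ C := (norm_nonneg _).trans (hC w)
  have hLc : Continuous L := hL.continuous
  have dD1 : Differentiable ℝ (fderiv ℝ L) :=
    (hL.fderiv_right (m := 2) (by norm_num)).differentiable (by norm_num)
  have hT : ∀ i, fderiv ℝ (fun x => fderiv ℝ L x (Pi.single i 1)) w (Pi.single i 1)
      = fderiv ℝ (fderiv ℝ L) w (Pi.single i 1) (Pi.single i 1) := by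
    intro i
    rw [fderiv_clm_apply (dD1 w) (differentiableAt_const _)]
    simp
  simp_rw [hT]
  set A := fderiv ℝ L w with hA
  set B := fderiv ℝ (fderiv ℝ L) w with hB
  set P := (Measure.pi fun _ : Fin n => gaussianReal 0 1) with hP
  set T := ∑ i, B (Pi.single i 1) (Pi.single i 1) * w i ^ 2 with hTd
  set V : (Fin n → ℝ) → (Fin n → ℝ) := fun γ i => γ i * |w i| with hV
  have hVn : ∀ γ, ‖V γ‖ ≤ ‖w‖ * ‖γ‖ := by
    intro γ
    refine (pi_norm_le_iff_of_nonneg (by positivity)).2 fun i => ?_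
    simp only [hV, norm_mul, Real.norm_eq_abs, abs_abs]
    rw [mul_comm]
    exact mul_le_mul (norm_le_pi_norm w i) (norm_le_pi_norm γ i) (abs_nonneg _) (norm_nonneg _)
  have hVs : ∀ (ρ : ℝ) γ, V (ρ • γ) = ρ • V γ := by
    intro ρ γ; ext i; simp [hV, mul_assoc]
  have hVc : Continuous V := by fun_prop
  have hsum : ∀ γ, V γ = ∑ i, (γ i * |w i|) • (Pi.single i 1 : Fin n → ℝ) := by
    intro γ
    exact pi_eq_sum_univ' (V γ)
  have hAe : ∀ γ, A (V γ) = ∑ i, γ i * (|w i| * A (Pi.single i 1)) := by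
    intro γ; rw [hsum]; simp [mul_assoc]
  have hBe : ∀ γ, B (V γ) (V γ)
      = ∑ i, ∑ j, (γ i * γ j) * (|w i| * |w j| * B (Pi.single i 1) (Pi.single j 1)) := by
    intro γ; rw [hsum]
    simp only [map_sum, map_smul, FunLike.coe_sum, Finset.sum_apply,
      FunLike.coe_smul, Pi.smul_apply, smul_eq_mul, Finset.mul_sum]
    refine Finset.sum_comm.trans ?_
    refine Finset.sum_congr rfl fun i _ => Finset.sum_congr rfl fun j _ => by ring
  have iA : Integrable (fun γ => A (V γ)) P := by
    simp_rw [hAe]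
    exact integrable_finsetSum _ fun i _ => (aux_lin n i).1.mul_const _
  have iB : Integrable (fun γ => B (V γ) (V γ)) P := by
    simp_rw [hBe]
    exact integrable_finsetSum _ fun i _ => integrable_finsetSum _ fun j _ =>
      (aux_cross n i j).1.mul_const _
  have eA : ∫ γ, A (V γ) ∂P = 0 := by
    simp_rw [hAe]
    rw [integral_finsetSum _ fun i _ => (aux_lin n i).1.mul_const _]
    simp_rw [integral_mul_const]
    simp [hP, (aux_lin n _).2]
  have eB : ∫ γ, B (V γ) (V γ) ∂P = T := by
    simp_rw [hBe]
    rw [integral_finsetSum _ fun i _ => integrable_finsetSum _ fun j _ =>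
      (aux_cross n i j).1.mul_const _]
    refine Finset.sum_congr rfl fun i _ => ?_
    rw [integral_finsetSum _ fun j _ => (aux_cross n i j).1.mul_const _]
    have hc : ∀ j, ∫ γ : Fin n → ℝ, γ i * γ j ∂P = if i = j then 1 else 0 :=
      fun j => (aux_cross n i j).2
    rw [Finset.sum_congr rfl fun j _ => (integral_mul_const _ _).trans (congrArg (· * _) (hc j))]
    simp
    ring
  have iK : Integrable (fun γ : Fin n → ℝ => C * ‖w‖ ^ 3 * ‖γ‖ ^ 3) P :=
    (aux_cube n).const_mul _
  set K := ∫ γ, C * ‖w‖ ^ 3 * ‖γ‖ ^ 3 ∂P with hK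
  have key : ∀ ρ : ℝ, 0 < ρ →
      |(∫ γ, L (w + V γ) ∂(Measure.pi fun _ : Fin n => gaussianReal 0 ((ρ ^ 2).toNNReal)))
        - L w - ρ ^ 2 / 2 * T| ≤ ρ ^ 3 * K := by
    intro ρ hρ
    rw [aux_scale n ρ (fun γ => L (w + V γ)) (by fun_prop)]
    have hb : ∀ γ, ‖L (w + V (ρ • γ)) - (L w + ρ * A (V γ) + ρ ^ 2 / 2 * B (V γ) (V γ))‖
        ≤ ρ ^ 3 * (C * ‖w‖ ^ 3 * ‖γ‖ ^ 3) := by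
      intro γ
      have := aux_taylor L hL C hC w (ρ • V γ)
      rw [hVs, Real.norm_eq_abs]
      calc _ = _ := by
            congr 1
            simp only [map_smul, FunLike.coe_smul, Pi.smul_apply, smul_eq_mul]
            ring
        _ ≤ _ := this
        _ = C * (ρ ^ 3 * ‖V γ‖ ^ 3) := by
            rw [norm_smul, Real.norm_eq_abs, abs_of_pos hρ]; ring
        _ ≤ C * (ρ ^ 3 * (‖w‖ * ‖γ‖) ^ 3) := by gcongr; exact hVn γ
        _ = _ := by ring
    have iQ1 : Integrable (fun γ => L w + ρ * A (V γ)) P :=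
      (integrable_const _).add (iA.const_mul _)
    have iQ : Integrable (fun γ => L w + ρ * A (V γ) + ρ ^ 2 / 2 * B (V γ) (V γ)) P :=
      iQ1.add (iB.const_mul _)
    have eQ : ∫ γ, (L w + ρ * A (V γ) + ρ ^ 2 / 2 * B (V γ) (V γ)) ∂P
        = L w + ρ ^ 2 / 2 * T := by
      rw [integral_add iQ1 (iB.const_mul _), integral_add (integrable_const _) (iA.const_mul _),
        integral_const_mul, integral_const_mul, eA, eB]
      simp [hP]
    have iR : Integrable (fun γ => L (w + V (ρ • γ))
        - (L w + ρ * A (V γ) + ρ ^ 2 / 2 * B (V γ) (V γ))) P :=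
      (iK.const_mul (ρ ^ 3)).mono' (by
        apply Continuous.aestronglyMeasurable
        fun_prop) (Eventually.of_forall hb)
    have iL : Integrable (fun γ => L (w + V (ρ • γ))) P := by
      refine (iR.add iQ).congr (Eventually.of_forall fun γ => ?_)
      simp only [Pi.add_apply, sub_add_cancel]
    have := norm_integral_le_of_norm_le (iK.const_mul (ρ ^ 3)) (Eventually.of_forall hb)
    rw [integral_sub iL iQ, eQ, integral_const_mul, Real.norm_eq_abs] at this
    rwa [sub_sub]
  rw [tendsto_iff_norm_sub_tendsto_zero]
  have hlim : Tendsto (fun ρ : ℝ => 2 * K * ρ) (nhdsWithin 0 (Set.Ioi 0)) (nhds 0) := by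
    have : Tendsto (fun ρ : ℝ => 2 * K * ρ) (nhds 0) (nhds (2 * K * 0)) :=
      (continuous_const.mul continuous_id).tendsto 0
    rw [mul_zero] at this
    exact this.mono_left nhdsWithin_le_nhds
  refine squeeze_zero' (Eventually.of_forall fun _ => norm_nonneg _) ?_ hlim
  filter_upwards [self_mem_nhdsWithin] with ρ hρ
  have hρ : 0 < ρ := hρ
  have hk := key ρ hρ
  set I := ∫ γ, L (w + V γ) ∂(Measure.pi fun _ : Fin n => gaussianReal 0 ((ρ ^ 2).toNNReal))
  have e : 2 / ρ ^ 2 * (I - L w) - T = 2 / ρ ^ 2 * (I - L w - ρ ^ 2 / 2 * T) := by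
    field_simp
  calc _ = ‖2 / ρ ^ 2 * (I - L w) - T‖ := rfl
    _ = 2 / ρ ^ 2 * |I - L w - ρ ^ 2 / 2 * T| := by
      rw [e, norm_mul, Real.norm_eq_abs, Real.norm_eq_abs, abs_of_pos (by positivity)]
    _ ≤ 2 / ρ ^ 2 * (ρ ^ 3 * K) := by gcongr
    _ = 2 * K * ρ := by field_simp
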